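/- Let F be a field, i a positive integer and n ≥ 2 an integer. Define ℓ: U_{1^n}(F) → F by ℓ(u) = z_{1,2} + z_{2,3} + ⋯ + z_{n−1,n}, where z ∈ Z_n is the upper-left n×n block of u. Then: (a) ℓ is a group homomorphism into the additive group of F; (b) ℓ vanishes on t(H_{2ni+1}(F)); (c) for u ∈ U_{1^{n−1}}(F) with blocks ((z₁, x₁, y₁), (0, I_{2ni+2}, x₁′), (0, 0, z₁*)), one has ℓ(u) = (z₁)_{1,2} + ⋯ + (z₁)_{n−2,n−1} + (x₁)_{n−1,1} (the functional defining the character ψ_{n−1}); (d) every g in the subgroup of Sp_{2n(i+1)}(F) generated by t(Sp_{2ni}(F)) and t(H_{2ni+1}(F)) normalizes U_{1^n}(F) and satisfies ℓ(g^{−1}·u·g) = ℓ(u) for all u ∈ U_{1^n}(F). -/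

import Mathlib

open Matrix

/-- The `k × k` permutation matrix with `1`'s along the main anti-diagonal. -/
def wM (F : Type*) [Field F] (k : ℕ) : Matrix (Fin k) (Fin k) F :=
  Matrix.of fun i j => if (i : ℕ) + (j : ℕ) + 1 = k then 1 else 0

/-- The `2k × 2k` matrix `J_k = ((0, w_k), (−w_k, 0))` defining the symplectic form. -/
def JM (F : Type*) [Field F] (k : ℕ) :
    Matrix (Fin k ⊕ Fin k) (Fin k ⊕ Fin k) F :=
  Matrix.fromBlocks 0 (wM F k) (-(wM F k)) 0

/-- The symplectic group `Sp_{2k}(F) = { g ∈ GL_{2k}(F) : ᵗg·J_k·g = J_k }`,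
as a set of `2k × 2k` matrices (indexed by `Fin k ⊕ Fin k`). -/
def Sp (F : Type*) [Field F] (k : ℕ) :
    Set (Matrix (Fin k ⊕ Fin k) (Fin k ⊕ Fin k) F) :=
  { g | IsUnit g ∧ gᵀ * JM F k * g = JM F k }

/-- The global (natural-number) index of a row/column index of a `2k × 2k` matrix. -/
def idx {k : ℕ} : Fin k ⊕ Fin k → ℕ
  | Sum.inl i => (i : ℕ)
  | Sum.inr i => k + (i : ℕ)

/-- Entry of a `2k × 2k` matrix (indexed by `Fin k ⊕ Fin k`) at global
positions `a, b < 2k` (junk value `0` outside). -/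
def ent2 {F : Type*} [Field F] {k : ℕ}
    (h : Matrix (Fin k ⊕ Fin k) (Fin k ⊕ Fin k) F) (a b : ℕ) : F :=
  if ha : a < k then
    if hb : b < k then h (Sum.inl ⟨a, ha⟩) (Sum.inl ⟨b, hb⟩)
    else if hb2 : b < 2 * k then h (Sum.inl ⟨a, ha⟩) (Sum.inr ⟨b - k, by omega⟩)
    else 0
  else if ha2 : a < 2 * k then
    if hb : b < k then h (Sum.inr ⟨a - k, by omega⟩) (Sum.inl ⟨b, hb⟩)
    else if hb2 : b < 2 * k then h (Sum.inr ⟨a - k, by omega⟩) (Sum.inr ⟨b - k, by omega⟩)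
    else 0
  else 0

/-- `t(h) = diag(I_n, h, I_n)` for `h` a `2ni × 2ni` matrix, as a
`2n(i+1) × 2n(i+1)` matrix. -/
def tmap (F : Type*) [Field F] (n i : ℕ)
    (h : Matrix (Fin (n * i) ⊕ Fin (n * i)) (Fin (n * i) ⊕ Fin (n * i)) F) :
    Matrix (Fin (n * (i + 1)) ⊕ Fin (n * (i + 1)))
      (Fin (n * (i + 1)) ⊕ Fin (n * (i + 1))) F :=
  Matrix.of fun p q =>
    if n ≤ idx p ∧ idx p < n + 2 * (n * i) ∧ n ≤ idx q ∧ idx q < n + 2 * (n * i) then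
      ent2 h (idx p - n) (idx q - n)
    else if idx p = idx q then 1 else 0

/-- The underlying set of the Heisenberg group `H_{2ni+1}(F)`: row vectors of
length `2ni` (indexed by `Fin ni ⊕ Fin ni`) together with a scalar. -/
abbrev Heis (F : Type*) [Field F] (n i : ℕ) :=
  ((Fin (n * i) ⊕ Fin (n * i)) → F) × F

/-- Heisenberg multiplication `(x,e)·(y,f) = (x+y, e+f+x·J₀·ᵗy)`. -/
def hmul {F : Type*} [Field F] {n i : ℕ} (p q : Heis F n i) : Heis F n i :=
  (p.1 + q.1, p.2 + q.2 + p.1 ⬝ᵥ (JM F (n * i) *ᵥ q.1))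

/-- Entry of a vector indexed by `Fin k ⊕ Fin k` at a global position `a < 2k`. -/
def vent {F : Type*} [Field F] {k : ℕ} (v : Fin k ⊕ Fin k → F) (a : ℕ) : F :=
  if h : a < k then v (Sum.inl ⟨a, h⟩)
  else if h2 : a < 2 * k then v (Sum.inr ⟨a - k, by omega⟩)
  else 0

/-- The matrix `diag(I_{n−1}, ((1, x, e), (0, I_{2ni}, x′), (0, 0, 1)), I_{n−1})`
in size `2n(i+1)`, for a row vector `x`, a column vector `x′` and a scalar `e`. -/
def TH (F : Type*) [Field F] (n i : ℕ)
    (x x' : Fin (n * i) ⊕ Fin (n * i) → F) (e : F) :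
    Matrix (Fin (n * (i + 1)) ⊕ Fin (n * (i + 1)))
      (Fin (n * (i + 1)) ⊕ Fin (n * (i + 1))) F :=
  Matrix.of fun p q =>
    if idx p = idx q then 1
    else if idx p + 1 = n ∧ n ≤ idx q ∧ idx q < n + 2 * (n * i) then
      vent x (idx q - n)
    else if idx p + 1 = n ∧ idx q + n = 2 * (n * (i + 1)) then e
    else if n ≤ idx p ∧ idx p < n + 2 * (n * i) ∧ idx q + n = 2 * (n * (i + 1)) then
      vent x' (idx p - n)
    else 0

/-- `t((x,e))`, the image of `(x,e) ∈ H_{2ni+1}(F)` in `Sp_{2n(i+1)}(F)`. -/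
def tH (F : Type*) [Field F] (n i : ℕ) (p : Heis F n i) :
    Matrix (Fin (n * (i + 1)) ⊕ Fin (n * (i + 1)))
      (Fin (n * (i + 1)) ⊕ Fin (n * (i + 1))) F :=
  TH F n i p.1 (JM F (n * i) *ᵥ p.1) p.2

/-- The unipotent radical `U_{1^p}` (for the flag of type `(1^p)` in
`Sp_{2n(i+1)}`): elements of `Sp_{2n(i+1)}(F)` of block form
`((z, x, y), (0, I, x′), (0, 0, z*))` with block sizes `p, 2n(i+1)−2p, p` and
`z` upper unitriangular, described by entrywise conditions in global
coordinates. -/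
def Ublk (F : Type*) [Field F] (n i p : ℕ) :
    Set (Matrix (Fin (n * (i + 1)) ⊕ Fin (n * (i + 1)))
      (Fin (n * (i + 1)) ⊕ Fin (n * (i + 1))) F) :=
  { g | g ∈ Sp F (n * (i + 1)) ∧
    (∀ a b, p ≤ idx a → idx b < p → g a b = 0) ∧
    (∀ a b, p ≤ idx a → idx a < 2 * (n * (i + 1)) - p →
      p ≤ idx b → idx b < 2 * (n * (i + 1)) - p →
      g a b = if idx a = idx b then 1 else 0) ∧
    (∀ a b, 2 * (n * (i + 1)) - p ≤ idx a → idx b < 2 * (n * (i + 1)) - p →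
      g a b = 0) ∧
    (∀ a b, idx a < p → idx b < p →
      (idx a = idx b → g a b = 1) ∧ (idx b < idx a → g a b = 0)) }

/-- The linear functional `ℓ(u) = z_{1,2} + z_{2,3} + ⋯ + z_{n−1,n}` on the
entries of the upper-left `n × n` block. -/
def ellFun (F : Type*) [Field F] (n i : ℕ)
    (g : Matrix (Fin (n * (i + 1)) ⊕ Fin (n * (i + 1)))
      (Fin (n * (i + 1)) ⊕ Fin (n * (i + 1))) F) : F :=
  ∑ j : Fin (n - 1),
    g (Sum.inl ⟨(j : ℕ), by
        have hj := j.isLt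
        have h1 : n * 1 ≤ n * (i + 1) := Nat.mul_le_mul (le_refl n) (by omega)
        omega⟩)
      (Sum.inl ⟨(j : ℕ) + 1, by
        have hj := j.isLt
        have h1 : n * 1 ≤ n * (i + 1) := Nat.mul_le_mul (le_refl n) (by omega)
        omega⟩)

theorem wM_apply (F : Type*) [Field F] (k : ℕ) (i j : Fin k) :
    wM F k i j = if j = i.rev then 1 else 0 := by
  simp only [wM, Matrix.of_apply, Fin.ext_iff, Fin.val_rev]
  congr 1
  apply propext
  omega

theorem wM_mul_apply {F : Type*} [Field F] {k : ℕ} {α : Type*} (A : Matrix (Fin k) α F)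
    (i : Fin k) (j : α) : (wM F k * A) i j = A i.rev j := by
  simp [Matrix.mul_apply, wM_apply]

theorem wM_transpose (F : Type*) [Field F] (k : ℕ) : (wM F k)ᵀ = wM F k := by
  ext i j
  simp only [wM, Matrix.of_apply, Matrix.transpose_apply, add_comm (i : ℕ)]

theorem mul_wM_apply {F : Type*} [Field F] {k : ℕ} {α : Type*} (A : Matrix α (Fin k) F)
    (i : α) (j : Fin k) : (A * wM F k) i j = A i j.rev := by
  rw [← Matrix.transpose_apply (A * wM F k), Matrix.transpose_mul, wM_transpose, wM_mul_apply,
    Matrix.transpose_apply]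

theorem wM_mul_self (F : Type*) [Field F] (k : ℕ) : wM F k * wM F k = 1 := by
  ext i j
  simp [wM_mul_apply, wM_apply, Matrix.one_apply, eq_comm]

theorem JM_transpose (F : Type*) [Field F] (k : ℕ) : (JM F k)ᵀ = -JM F k := by
  simp [JM, Matrix.fromBlocks_transpose, Matrix.fromBlocks_neg, wM_transpose]

theorem JM_mul_self (F : Type*) [Field F] (k : ℕ) : JM F k * JM F k = -1 := by
  simp [JM, Matrix.fromBlocks_multiply, wM_mul_self, ← Matrix.fromBlocks_one,
    Matrix.fromBlocks_neg]

theorem dotProduct_JM_mulVec_self {F : Type*} [Field F] {k : ℕ} (x : Fin k ⊕ Fin k → F) :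
    x ⬝ᵥ (JM F k *ᵥ x) = 0 := by
  simp only [JM, Matrix.fromBlocks_mulVec, Matrix.zero_mulVec, zero_add, add_zero,
    dotProduct, Fintype.sum_sum_type, Sum.elim_inl, Sum.elim_inr, Matrix.neg_mulVec,
    Pi.neg_apply]
  simp only [mul_neg, Finset.sum_neg_distrib, ← sub_eq_add_neg, sub_eq_zero]
  simp only [Matrix.mulVec, dotProduct, wM_apply, ite_mul, one_mul, zero_mul,
    Finset.sum_ite_eq', Finset.mem_univ, if_true]
  exact Fintype.sum_equiv Fin.revPerm _ _ fun a => by simp [mul_comm]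

theorem mem_Sp_iff {F : Type*} [Field F] {k : ℕ}
    {g : Matrix (Fin k ⊕ Fin k) (Fin k ⊕ Fin k) F} :
    g ∈ Sp F k ↔ gᵀ * JM F k * g = JM F k := by
  refine ⟨fun h => h.2, fun h => ⟨?_, h⟩⟩
  have h1 : (-(JM F k * (gᵀ * JM F k))) * g = 1 := by
    rw [Matrix.neg_mul, Matrix.mul_assoc, h, JM_mul_self, neg_neg]
  exact .of_mul_eq_one_right _ h1

theorem mul_mem_Sp {F : Type*} [Field F] {k : ℕ}
    {g h : Matrix (Fin k ⊕ Fin k) (Fin k ⊕ Fin k) F} (hg : g ∈ Sp F k) (hh : h ∈ Sp F k) :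
    g * h ∈ Sp F k := by
  refine mem_Sp_iff.2 ?_
  calc (g * h)ᵀ * JM F k * (g * h) = hᵀ * (gᵀ * JM F k * g) * h := by
        simp only [Matrix.transpose_mul, Matrix.mul_assoc]
    _ = JM F k := by rw [hg.2, hh.2]

theorem inv_mem_Sp {F : Type*} [Field F] {k : ℕ}
    {g : Matrix (Fin k ⊕ Fin k) (Fin k ⊕ Fin k) F} (hg : g ∈ Sp F k) : g⁻¹ ∈ Sp F k := by
  refine mem_Sp_iff.2 ?_
  have h1 : g * g⁻¹ = 1 := Matrix.mul_nonsing_inv _ ((Matrix.isUnit_iff_isUnit_det _).1 hg.1)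
  calc (g⁻¹)ᵀ * JM F k * g⁻¹ = (g⁻¹)ᵀ * (gᵀ * JM F k * g) * g⁻¹ := by rw [hg.2]
    _ = (g * g⁻¹)ᵀ * JM F k * (g * g⁻¹) := by
        simp only [Matrix.transpose_mul, Matrix.mul_assoc]
    _ = JM F k := by rw [h1]; simp

theorem idx_injective {k : ℕ} : Function.Injective (idx : Fin k ⊕ Fin k → ℕ) := by
  rintro (a | a) (b | b) h <;> simp only [idx] at h <;> simp [Fin.ext_iff] <;> omega

theorem idx_lt {k : ℕ} (a : Fin k ⊕ Fin k) : idx a < 2 * k := by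
  rcases a with a | a <;> simp only [idx] <;> omega

theorem ent2_idx {F : Type*} [Field F] {k : ℕ}
    (h : Matrix (Fin k ⊕ Fin k) (Fin k ⊕ Fin k) F) (a b : Fin k ⊕ Fin k) :
    ent2 h (idx a) (idx b) = h a b := by
  rcases a with a | a <;> rcases b with b | b <;> simp [ent2, idx, two_mul]

theorem vent_idx {F : Type*} [Field F] {k : ℕ} (v : Fin k ⊕ Fin k → F) (a : Fin k ⊕ Fin k) :
    vent v (idx a) = v a := by
  rcases a with a | a <;> simp [vent, idx, two_mul]

/-- The outer `n + n` and the inner `2ni` indices inside the `2n(i+1)` indices. -/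
def outerInner (n i : ℕ) : (Fin n ⊕ Fin n) ⊕ (Fin (n * i) ⊕ Fin (n * i)) →
    Fin (n * (i + 1)) ⊕ Fin (n * (i + 1))
  | .inl (.inl a) => .inl ⟨a, by rw [Nat.mul_succ]; omega⟩
  | .inl (.inr a) => .inr ⟨n * i + a, by rw [Nat.mul_succ]; omega⟩
  | .inr (.inl a) => .inl ⟨n + a, by rw [Nat.mul_succ]; omega⟩
  | .inr (.inr a) => .inr ⟨a, by rw [Nat.mul_succ]; omega⟩

theorem outerInner_bijective (n i : ℕ) : Function.Bijective (outerInner n i) := by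
  refine (Fintype.bijective_iff_injective_and_card _).2 ⟨?_, ?_⟩
  · rintro ((a | a) | (a | a)) ((b | b) | (b | b)) h <;>
      simp only [outerInner, Sum.inl.injEq, Sum.inr.injEq, Fin.ext_iff, reduceCtorEq] at h <;>
      simp [Fin.ext_iff] <;> omega
  · simp [Nat.mul_succ]
    omega

/-- `outerInner` as an equivalence. -/
noncomputable def outerInnerEquiv (n i : ℕ) : (Fin n ⊕ Fin n) ⊕ (Fin (n * i) ⊕ Fin (n * i)) ≃
    Fin (n * (i + 1)) ⊕ Fin (n * (i + 1)) :=
  .ofBijective _ (outerInner_bijective n i)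

theorem idx_outerInner_outer_left {n i : ℕ} (a : Fin n) :
    idx (outerInnerEquiv n i (.inl (.inl a))) = a := rfl

theorem idx_outerInner_outer_right {n i : ℕ} (a : Fin n) :
    idx (outerInnerEquiv n i (.inl (.inr a))) = n + 2 * (n * i) + a := by
  change n * (i + 1) + (n * i + a) = _
  rw [Nat.mul_succ]
  omega

theorem idx_outerInner_inner {n i : ℕ} (a : Fin (n * i) ⊕ Fin (n * i)) :
    idx (outerInnerEquiv n i (.inr a)) = n + idx a := by
  rcases a with a | a
  · rfl
  · change n * (i + 1) + (a : ℕ) = n + (n * i + a)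
    rw [Nat.mul_succ]
    omega

theorem JM_submatrix_outerInner (F : Type*) [Field F] (n i : ℕ) :
    (JM F (n * (i + 1))).submatrix (outerInnerEquiv n i) (outerInnerEquiv n i) =
      fromBlocks (JM F n) 0 0 (JM F (n * i)) := by
  have hN := Nat.mul_succ n i
  ext ((a | a) | (a | a)) ((b | b) | (b | b)) <;>
    simp [outerInnerEquiv, outerInner, JM, wM] <;> grind

theorem mem_Sp_of_submatrix {F : Type*} [Field F] {n i : ℕ}
    {g : Matrix (Fin (n * (i + 1)) ⊕ Fin (n * (i + 1)))
      (Fin (n * (i + 1)) ⊕ Fin (n * (i + 1))) F}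
    {A : Matrix (Fin n ⊕ Fin n) (Fin n ⊕ Fin n) F}
    {B : Matrix (Fin n ⊕ Fin n) (Fin (n * i) ⊕ Fin (n * i)) F}
    {C : Matrix (Fin (n * i) ⊕ Fin (n * i)) (Fin n ⊕ Fin n) F}
    {D : Matrix (Fin (n * i) ⊕ Fin (n * i)) (Fin (n * i) ⊕ Fin (n * i)) F}
    (hg : g.submatrix (outerInnerEquiv n i) (outerInnerEquiv n i) = fromBlocks A B C D)
    (hA : Aᵀ * JM F n * A + Cᵀ * JM F (n * i) * C = JM F n)
    (hB : Aᵀ * JM F n * B + Cᵀ * JM F (n * i) * D = 0)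
    (hC : Bᵀ * JM F n * A + Dᵀ * JM F (n * i) * C = 0)
    (hD : Bᵀ * JM F n * B + Dᵀ * JM F (n * i) * D = JM F (n * i)) :
    g ∈ Sp F (n * (i + 1)) := by
  refine mem_Sp_iff.2 ?_
  have key : (gᵀ * JM F (n * (i + 1)) * g).submatrix (outerInnerEquiv n i)
      (outerInnerEquiv n i) =
      (JM F (n * (i + 1))).submatrix (outerInnerEquiv n i) (outerInnerEquiv n i) := by
    rw [← Matrix.submatrix_mul_equiv _ _ _ (outerInnerEquiv n i),
      ← Matrix.submatrix_mul_equiv _ _ _ (outerInnerEquiv n i),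
      ← Matrix.transpose_submatrix, hg, JM_submatrix_outerInner,
      Matrix.fromBlocks_transpose, Matrix.fromBlocks_multiply, Matrix.fromBlocks_multiply]
    simp [hA, hB, hC, hD]
  ext a b
  simpa using congr_fun₂ key ((outerInnerEquiv n i).symm a) ((outerInnerEquiv n i).symm b)

theorem tmap_submatrix_outerInner {F : Type*} [Field F] {n i : ℕ}
    (h : Matrix (Fin (n * i) ⊕ Fin (n * i)) (Fin (n * i) ⊕ Fin (n * i)) F) :
    (tmap F n i h).submatrix (outerInnerEquiv n i) (outerInnerEquiv n i) =
      fromBlocks 1 0 0 h := by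
  ext ((a | a) | a) ((b | b) | b) <;>
    simp only [Matrix.submatrix_apply, tmap, Matrix.of_apply, idx_outerInner_outer_left,
      idx_outerInner_outer_right, idx_outerInner_inner, Matrix.fromBlocks_apply₁₁,
      Matrix.fromBlocks_apply₁₂, Matrix.fromBlocks_apply₂₁, Matrix.fromBlocks_apply₂₂,
      Matrix.one_apply, Matrix.zero_apply, Sum.inl.injEq, Sum.inr.injEq, reduceCtorEq,
      Nat.add_sub_cancel_left, ent2_idx, Fin.ext_iff]
  all_goals
    try have ha := idx_lt a
    try have hb := idx_lt b
    grind

theorem tmap_mem_Sp {F : Type*} [Field F] {n i : ℕ}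
    {h : Matrix (Fin (n * i) ⊕ Fin (n * i)) (Fin (n * i) ⊕ Fin (n * i)) F}
    (hh : h ∈ Sp F (n * i)) : tmap F n i h ∈ Sp F (n * (i + 1)) :=
  mem_Sp_of_submatrix (tmap_submatrix_outerInner h) (by simp) (by simp) (by simp)
    (by simpa using hh.2)

/-- The `n × k` matrix whose last row is `x`, all other rows being zero. -/
def lastRow {F : Type*} [Field F] (n : ℕ) {α : Type*} (x : α → F) : Matrix (Fin n) α F :=
  Matrix.of fun a k => if (a : ℕ) + 1 = n then x k else 0

theorem TH_submatrix_outerInner {F : Type*} [Field F] {n i : ℕ}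
    (x x' : Fin (n * i) ⊕ Fin (n * i) → F) (e : F) :
    (TH F n i x x' e).submatrix (outerInnerEquiv n i) (outerInnerEquiv n i) =
      fromBlocks (fromBlocks 1 (lastRow n fun b : Fin n => if (b : ℕ) = 0 then e else 0) 0 1)
        (fromRows (lastRow n x) 0) (fromCols 0 ((lastRow n x')ᵀ * wM F n)) 1 := by
  have hN := Nat.mul_succ n i
  ext ((a | a) | a) ((b | b) | b) <;>
    simp only [Matrix.submatrix_apply, TH, Matrix.of_apply, idx_outerInner_outer_left,
      idx_outerInner_outer_right, idx_outerInner_inner, Matrix.fromBlocks_apply₁₁,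
      Matrix.fromBlocks_apply₁₂, Matrix.fromBlocks_apply₂₁, Matrix.fromBlocks_apply₂₂,
      Matrix.one_apply, Matrix.zero_apply, Matrix.fromRows_apply_inl,
      Matrix.fromRows_apply_inr, Matrix.fromCols_apply_inl, Matrix.fromCols_apply_inr,
      mul_wM_apply, Matrix.transpose_apply, lastRow, Fin.val_rev,
      Nat.add_sub_cancel_left, vent_idx, Fin.ext_iff, ← idx_injective.eq_iff]
  all_goals
    try have ha := idx_lt a
    try have hb := idx_lt b
    grind

theorem tH_mem_Sp {F : Type*} [Field F] {n i : ℕ} (p : Heis F n i) :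
    tH F n i p ∈ Sp F (n * (i + 1)) := by
  obtain ⟨x, e⟩ := p
  set X : Matrix (Fin n) _ F := lastRow n x with hX
  set Y : Matrix (Fin n) (Fin n) F := lastRow n fun b : Fin n => if (b : ℕ) = 0 then e else 0 with hY
  have hX' : (lastRow n (JM F (n * i) *ᵥ x))ᵀ = JM F (n * i) * Xᵀ := by
    ext a b
    by_cases hb : (b : ℕ) + 1 = n <;>
      simp [hX, lastRow, Matrix.mul_apply, Matrix.mulVec, dotProduct, hb]
  have hXJX : X * (JM F (n * i) * Xᵀ) = 0 := by
    rw [← hX']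
    ext a b
    have h := dotProduct_JM_mulVec_self x
    by_cases ha : (a : ℕ) + 1 = n <;> by_cases hb : (b : ℕ) + 1 = n <;>
      simp [hX, lastRow, Matrix.mul_apply, ha, hb]
    exact (Fintype.sum_sum_type _).symm.trans h
  have hYw : Yᵀ * wM F n = wM F n * Y := by
    ext a b
    simp only [hY, mul_wM_apply, wM_mul_apply, Matrix.transpose_apply, lastRow,
      Matrix.of_apply, Fin.val_rev]
    grind
  have hJJ : ∀ Z : Matrix (Fin (n * i) ⊕ Fin (n * i)) (Fin n) F,
      JM F (n * i) * (JM F (n * i) * Z) = -Z := fun Z => by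
    rw [← Matrix.mul_assoc, JM_mul_self, Matrix.neg_mul, Matrix.one_mul]
  have hXw : X * (JM F (n * i) * (Xᵀ * wM F n)) = 0 := by
    rw [← Matrix.mul_assoc (JM F (n * i)), ← Matrix.mul_assoc X, hXJX, Matrix.zero_mul]
  have h0 := TH_submatrix_outerInner x (JM F (n * i) *ᵥ x) e
  rw [hX', ← hX, ← hY] at h0
  refine mem_Sp_of_submatrix h0 ?_ ?_ ?_ ?_
  all_goals
    rw [show JM F n = fromBlocks 0 (wM F n) (-wM F n) 0 from rfl]
    simp [Matrix.fromBlocks_transpose, Matrix.transpose_fromRows, Matrix.transpose_fromCols,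
      JM_transpose, wM_transpose, Matrix.mul_assoc, Matrix.fromBlocks_multiply,
      Matrix.fromBlocks_mul_fromRows, Matrix.fromCols_mul_fromRows,
      Matrix.fromCols_mul_fromBlocks, hJJ, JM_mul_self, hXw, hYw]
  · ext (a | a) b <;> simp
  · ext a (b | b) <;> simp

/-- The block of an index for the block sizes `1, …, 1, 2ni, n`. -/
def flagBlock (n i : ℕ) (a : Fin (n * (i + 1)) ⊕ Fin (n * (i + 1))) : ℕ :=
  if idx a < n then idx a else if idx a < n + 2 * (n * i) then n else n + 1

theorem mul_apply_eq_sum_block {R m : Type*} [Fintype m] [CommRing R]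
    {bl : m → ℕ} {A B : Matrix m m R} (hA : BlockTriangular A bl) (hB : BlockTriangular B bl)
    (a b : m) :
    (A * B) a b = ∑ k, if bl a ≤ bl k ∧ bl k ≤ bl b then A a k * B k b else 0 := by
  rw [Matrix.mul_apply]
  refine Finset.sum_congr rfl fun k _ => ?_
  split_ifs with h
  · rfl
  · rcases not_and_or.1 h with h | h
    · rw [hA (not_le.1 h), zero_mul]
    · rw [hB (not_le.1 h), mul_zero]

/-- The matrices in the stabilizer of the flag that are unipotent on its first `n` steps. -/
def flagSubmonoid (F : Type*) [Field F] (n i : ℕ) :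
    Submonoid (Matrix (Fin (n * (i + 1)) ⊕ Fin (n * (i + 1)))
      (Fin (n * (i + 1)) ⊕ Fin (n * (i + 1))) F) where
  carrier := { g | g ∈ Sp F (n * (i + 1)) ∧ BlockTriangular g (flagBlock n i) ∧
    ∀ a, idx a < n → g a a = 1 }
  one_mem' := ⟨mem_Sp_iff.2 (by simp), blockTriangular_one, fun a _ => by simp⟩
  mul_mem' := by
    rintro g h ⟨hg, hgb, hg1⟩ ⟨hh, hhb, hh1⟩
    refine ⟨mul_mem_Sp hg hh, hgb.mul hhb, fun a ha => ?_⟩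
    rw [mul_apply_eq_sum_block hgb hhb, Finset.sum_eq_single a]
    · simp [hg1 a ha, hh1 a ha]
    · intro k _ hk
      refine if_neg fun h => hk (idx_injective ?_)
      grind [flagBlock]
    · simp

theorem inv_mem_flagSubmonoid {F : Type*} [Field F] {n i : ℕ}
    {g : Matrix (Fin (n * (i + 1)) ⊕ Fin (n * (i + 1)))
      (Fin (n * (i + 1)) ⊕ Fin (n * (i + 1))) F} (hg : g ∈ flagSubmonoid F n i) :
    g⁻¹ ∈ flagSubmonoid F n i := by
  obtain ⟨hs, hb, h1⟩ := hg
  have : Invertible g := hs.1.invertible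
  have hb' := blockTriangular_inv_of_blockTriangular hb
  refine ⟨inv_mem_Sp hs, hb', fun a ha => ?_⟩
  have h2 : (g⁻¹ * g) a a = 1 := by simp
  rw [mul_apply_eq_sum_block hb' hb, Finset.sum_eq_single a] at h2
  · simpa [h1 a ha] using h2
  · intro k _ hk
    refine if_neg fun h => hk (idx_injective ?_)
    grind [flagBlock]
  · simp

theorem tmap_mem_flagSubmonoid {F : Type*} [Field F] {n i : ℕ}
    {h : Matrix (Fin (n * i) ⊕ Fin (n * i)) (Fin (n * i) ⊕ Fin (n * i)) F}
    (hh : h ∈ Sp F (n * i)) : tmap F n i h ∈ flagSubmonoid F n i := by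
  refine ⟨tmap_mem_Sp hh, fun a b hab => ?_, fun a ha => ?_⟩
  · simp only [tmap, Matrix.of_apply]
    grind [flagBlock]
  · simp only [tmap, Matrix.of_apply]
    grind

theorem tH_mem_flagSubmonoid {F : Type*} [Field F] {n i : ℕ} (p : Heis F n i) :
    tH F n i p ∈ flagSubmonoid F n i := by
  have hN := Nat.mul_succ n i
  refine ⟨tH_mem_Sp p, fun a b hab => ?_, fun a ha => by simp [tH, TH]⟩
  simp only [tH, TH, Matrix.of_apply]
  grind [flagBlock]

theorem mem_Ublk_iff {F : Type*} [Field F] {n i : ℕ}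
    {u : Matrix (Fin (n * (i + 1)) ⊕ Fin (n * (i + 1)))
      (Fin (n * (i + 1)) ⊕ Fin (n * (i + 1))) F} :
    u ∈ Ublk F n i n ↔ u ∈ flagSubmonoid F n i ∧
      ∀ a b, flagBlock n i a = n → flagBlock n i b = n →
        u a b = (1 : Matrix _ _ F) a b := by
  have hN : 2 * (n * (i + 1)) - n = n + 2 * (n * i) := by
    rw [Nat.mul_succ]
    omega
  have hmid : ∀ a : Fin (n * (i + 1)) ⊕ Fin (n * (i + 1)),
      flagBlock n i a = n ↔ n ≤ idx a ∧ idx a < n + 2 * (n * i) := fun a => by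
    grind [flagBlock]
  simp only [Ublk, hN, Set.mem_ofPred_eq, hmid, Matrix.one_apply, ← idx_injective.eq_iff]
  constructor
  · rintro ⟨hs, h1, h2, h3, h4⟩
    refine ⟨⟨hs, fun a b hab => ?_, fun a ha => (h4 a a ha ha).1 rfl⟩,
      fun a b ha hb => h2 a b ha.1 ha.2 hb.1 hb.2⟩
    have h1 := h1 a b
    have h3 := h3 a b
    have h4 := h4 a b
    grind [flagBlock]
  · rintro ⟨⟨hs, hb, hd⟩, hm⟩
    refine ⟨hs, fun a b h h' => hb ?_, fun a b ha ha' hb hb' => hm a b ⟨ha, ha'⟩ ⟨hb, hb'⟩,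
      fun a b h h' => hb ?_, fun a b ha hb' => ⟨fun h => ?_, fun h => hb ?_⟩⟩
    · grind [flagBlock]
    · grind [flagBlock]
    · rw [← idx_injective h, hd a ha]
    · grind [flagBlock]

theorem conj_mem_Ublk {F : Type*} [Field F] {n i : ℕ}
    {g u : Matrix (Fin (n * (i + 1)) ⊕ Fin (n * (i + 1)))
      (Fin (n * (i + 1)) ⊕ Fin (n * (i + 1))) F} (hg : g ∈ flagSubmonoid F n i)
    (hu : u ∈ Ublk F n i n) : g⁻¹ * u * g ∈ Ublk F n i n := by
  obtain ⟨hu, hm⟩ := mem_Ublk_iff.1 hu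
  have hg' := inv_mem_flagSubmonoid hg
  refine mem_Ublk_iff.2 ⟨mul_mem (mul_mem hg' hu) hg, fun a b ha hb => ?_⟩
  have hgu : ∀ k, flagBlock n i k = n → (g⁻¹ * u) a k = g⁻¹ a k := fun k hk => by
    conv_rhs => rw [← Matrix.mul_one g⁻¹]
    rw [mul_apply_eq_sum_block hg'.2.1 hu.2.1,
      mul_apply_eq_sum_block hg'.2.1 blockTriangular_one]
    refine Finset.sum_congr rfl fun l _ => ?_
    split_ifs with h
    · rw [hm l k (by omega) hk]
    · rfl
  have hinv : g⁻¹ * g = 1 :=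
    Matrix.nonsing_inv_mul _ ((Matrix.isUnit_iff_isUnit_det _).1 hg.1.1)
  rw [← hinv, mul_apply_eq_sum_block (mul_mem hg' hu).2.1 hg.2.1,
    mul_apply_eq_sum_block hg'.2.1 hg.2.1]
  refine Finset.sum_congr rfl fun l _ => ?_
  split_ifs with h
  · rw [hgu l (by omega)]
  · rfl

theorem ellFun_mul {F : Type*} [Field F] {n i : ℕ}
    {g h : Matrix (Fin (n * (i + 1)) ⊕ Fin (n * (i + 1)))
      (Fin (n * (i + 1)) ⊕ Fin (n * (i + 1))) F} (hg : g ∈ flagSubmonoid F n i)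
    (hh : h ∈ flagSubmonoid F n i) :
    ellFun F n i (g * h) = ellFun F n i g + ellFun F n i h := by
  simp only [ellFun, ← Finset.sum_add_distrib]
  refine Finset.sum_congr rfl fun j _ => ?_
  have hj := j.isLt
  rw [mul_apply_eq_sum_block hg.2.1 hh.2.1, Finset.sum_eq_add_of_mem _ _
    (Finset.mem_univ (Sum.inl ⟨j + 1, _⟩)) (Finset.mem_univ (Sum.inl ⟨j, _⟩))]
  · rw [if_pos, if_pos, hh.2.2 _ (by simp only [idx]; omega),
      hg.2.2 _ (by simp only [idx]; omega), mul_one, one_mul]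
    all_goals simp only [flagBlock, idx]; grind
  · simp
  · rintro k - ⟨hk, hk'⟩
    rw [Ne, ← idx_injective.eq_iff] at hk hk'
    simp only [idx] at hk hk'
    refine if_neg ?_
    simp only [flagBlock, idx]
    grind [idx]

theorem ellFun_one (F : Type*) [Field F] (n i : ℕ) : ellFun F n i 1 = 0 :=
  Finset.sum_eq_zero fun j _ => by simp

theorem ellFun_conj {F : Type*} [Field F] {n i : ℕ}
    {g u : Matrix (Fin (n * (i + 1)) ⊕ Fin (n * (i + 1)))
      (Fin (n * (i + 1)) ⊕ Fin (n * (i + 1))) F} (hg : g ∈ flagSubmonoid F n i)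
    (hu : u ∈ flagSubmonoid F n i) : ellFun F n i (g⁻¹ * u * g) = ellFun F n i u := by
  have hg' := inv_mem_flagSubmonoid hg
  have hinv : g⁻¹ * g = 1 :=
    Matrix.nonsing_inv_mul _ ((Matrix.isUnit_iff_isUnit_det _).1 hg.1.1)
  have h := ellFun_mul hg' hg
  rw [hinv, ellFun_one] at h
  rw [ellFun_mul (mul_mem hg' hu) hg, ellFun_mul hg' hu, add_right_comm, ← h, zero_add]

/-- Properties of `ℓ`: it is a homomorphism `U_{1^n}(F) → (F,+)`, it vanishes on
`t(H_{2ni+1}(F))`, on `U_{1^{n−1}}(F)` it equals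
`(z₁)_{1,2} + ⋯ + (z₁)_{n−2,n−1} + (x₁)_{n−1,1}` (the functional defining `ψ_{n−1}`),
and it is invariant under conjugation by the subgroup generated by
`t(Sp_{2ni}(F))` and `t(H_{2ni+1}(F))`, which normalizes `U_{1^n}(F)`. -/
theorem ell_hom_vanishing_and_invariance (F : Type*) [Field F] (n i : ℕ)
    (hn : 2 ≤ n) (hi : 1 ≤ i) :
    (∀ u ∈ Ublk F n i n, ∀ v ∈ Ublk F n i n,
      ellFun F n i (u * v) = ellFun F n i u + ellFun F n i v) ∧
    (∀ p : Heis F n i, ellFun F n i (tH F n i p) = 0) ∧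
    (∀ u ∈ Ublk F n i (n - 1),
      ellFun F n i u =
        (∑ j : Fin (n - 2),
          u (Sum.inl ⟨(j : ℕ), by
              have hj := j.isLt
              have h1 : n * 1 ≤ n * (i + 1) := Nat.mul_le_mul (le_refl n) (by omega)
              omega⟩)
            (Sum.inl ⟨(j : ℕ) + 1, by
              have hj := j.isLt
              have h1 : n * 1 ≤ n * (i + 1) := Nat.mul_le_mul (le_refl n) (by omega)
              omega⟩)) +
        u (Sum.inl ⟨n - 2, by
            have h1 : n * 1 ≤ n * (i + 1) := Nat.mul_le_mul (le_refl n) (by omega)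
            omega⟩)
          (Sum.inl ⟨n - 1, by
            have h1 : n * 1 ≤ n * (i + 1) := Nat.mul_le_mul (le_refl n) (by omega)
            omega⟩)) ∧
    (∀ g ∈ Submonoid.closure
        ({ g | ∃ h ∈ Sp F (n * i), g = tmap F n i h } ∪ Set.range (tH F n i)),
      ∀ u ∈ Ublk F n i n,
        g⁻¹ * u * g ∈ Ublk F n i n ∧ ellFun F n i (g⁻¹ * u * g) = ellFun F n i u) := by
  refine ⟨fun u hu v hv => ellFun_mul (mem_Ublk_iff.1 hu).1 (mem_Ublk_iff.1 hv).1,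
    fun p => ?_, fun u _ => ?_, fun g hg u hu => ?_⟩
  · refine Finset.sum_eq_zero fun j _ => ?_
    have hj := j.isLt
    have hN := Nat.mul_succ n i
    simp only [tH, TH, Matrix.of_apply, idx]
    grind
  · obtain ⟨m, rfl⟩ := Nat.exists_eq_add_of_le' hn
    exact Fin.sum_univ_castSucc (n := m) _
  · have hg' : g ∈ flagSubmonoid F n i := by
      refine Submonoid.closure_le.2 ?_ hg
      rintro _ (⟨h, hh, rfl⟩ | ⟨p, rfl⟩)
      · exact tmap_mem_flagSubmonoid hh
      · exact tH_mem_flagSubmonoid p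
    exact ⟨conj_mem_Ublk hg' hu, ellFun_conj hg' (mem_Ublk_iff.1 hu).1⟩
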